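/- Let m, k, κ₀ > 0, ω = √(k/m), and let q, p : ℝ → ℝ be twice differentiable curves satisfying q̇ = p/m and ṗ = −k·q, with (q(t), p(t)) ≠ (0,0) for all t. Define z_dH(t) = (1/√2)(p(t)/m + i·κ₀·k·q(t)). Then ż_dH(t) ≠ 0 for all t, and the signed curvature of the curve z_dH, namely κ(t) = Im(z̈_dH(t)·conj(ż_dH(t)))/‖ż_dH(t)‖³, satisfies κ(t) = κ₀·ω⁴·E / ‖ż_dH(t)‖³, where E = H(q(t),p(t)) = p(t)²/(2m) + k·q(t)²/2 is the (constant) energy of the trajectory. -/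

import Mathlib

open Complex

/-- A scaled plane curve given by its real and imaginary parts is differentiated componentwise. -/
lemma HasDerivAt.ofReal_mul_mk {x y : ℝ → ℝ} {x' y' t : ℝ} (c : ℝ)
    (hx : HasDerivAt x x' t) (hy : HasDerivAt y y' t) :
    HasDerivAt (fun s => (c : ℂ) * ((x s : ℂ) + I * (y s : ℂ)))
      ((c : ℂ) * ((x' : ℂ) + I * (y' : ℂ))) t :=
  (hx.ofReal_comp.add (hy.ofReal_comp.const_mul I)).const_mul _

/-- Along a nontrivial harmonic-oscillator trajectory, the complex dual curve
`z_dH(t) = (1/√2)(p(t)/m + iκ₀k·q(t))` has nonvanishing velocity and its signed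
curvature `κ(t) = Im(z̈_dH·conj(ż_dH))/‖ż_dH‖³` satisfies
`κ(t) = κ₀·ω⁴·E/‖ż_dH(t)‖³`, where `E = p(t)²/(2m) + k·q(t)²/2` is the energy. -/
theorem curvature_proportional_to_energy
    (m k κ₀ : ℝ) (hm : 0 < m) (hk : 0 < k) (hκ₀ : 0 < κ₀)
    (ω : ℝ) (hω : ω = Real.sqrt (k / m))
    (q p : ℝ → ℝ)
    (hq : Differentiable ℝ q) (hq' : Differentiable ℝ (deriv q))
    (hp : Differentiable ℝ p) (hp' : Differentiable ℝ (deriv p))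
    (ham_q : ∀ t, deriv q t = p t / m)
    (ham_p : ∀ t, deriv p t = -(k * q t))
    (hne : ∀ t, (q t, p t) ≠ (0, 0))
    (zdH : ℝ → ℂ)
    (hz : ∀ t, zdH t
      = (1 / Real.sqrt 2 : ℂ) * ((p t / m : ℝ) + Complex.I * (κ₀ : ℂ) * (k : ℂ) * (q t : ℝ))) :
    (∀ t, deriv zdH t ≠ 0)
      ∧ (∀ t, (deriv (deriv zdH) t * (starRingEnd ℂ) (deriv zdH t)).im / ‖deriv zdH t‖ ^ 3
          = κ₀ * ω ^ 4 * (p t ^ 2 / (2 * m) + k * q t ^ 2 / 2) / ‖deriv zdH t‖ ^ 3) := by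
  set c : ℝ := 1 / Real.sqrt 2 with hc
  have hc2 : c ^ 2 = 1 / 2 := by
    rw [hc, div_pow, Real.sq_sqrt (by norm_num)]
    norm_num
  have hc0 : c ≠ 0 := by positivity
  have hω4 : ω ^ 4 = (k / m) ^ 2 := by
    rw [hω, show 4 = 2 * 2 from rfl, pow_mul, Real.sq_sqrt (by positivity)]
  have hdq : ∀ t, HasDerivAt q (p t / m) t := fun t => ham_q t ▸ (hq t).hasDerivAt
  have hdp : ∀ t, HasDerivAt p (-(k * q t)) t := fun t => ham_p t ▸ (hp t).hasDerivAt
  have hz_eq : zdH = fun t => (c : ℂ) * (((p t / m : ℝ) : ℂ) + I * ((κ₀ * k * q t : ℝ) : ℂ)) := by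
    funext t
    rw [hz t, hc]
    push_cast
    ring
  have hz_deriv : deriv zdH = fun t =>
      (c : ℂ) * (((-(k * q t) / m : ℝ) : ℂ) + I * ((κ₀ * k * (p t / m) : ℝ) : ℂ)) := by
    funext t
    rw [hz_eq]
    exact (((hdp t).div_const m).ofReal_mul_mk c ((hdq t).const_mul (κ₀ * k))).deriv
  have hz_deriv2 : ∀ t, deriv (deriv zdH) t =
      (c : ℂ) * (((-(k * (p t / m)) / m : ℝ) : ℂ) +
        I * ((κ₀ * k * (-(k * q t) / m) : ℝ) : ℂ)) := by
    intro t
    rw [hz_deriv]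
    exact (((((hdq t).const_mul k).neg).div_const m).ofReal_mul_mk c
      (((hdp t).div_const m).const_mul (κ₀ * k))).deriv
  refine ⟨fun t h => hne t ?_, fun t => ?_⟩
  · rw [hz_deriv] at h
    have h' := (mul_eq_zero.mp h).resolve_left (ofReal_ne_zero.mpr hc0)
    have hre := congrArg re h'
    have him := congrArg im h'
    simp only [add_re, add_im, mul_re, mul_im, ofReal_re, ofReal_im, I_re, I_im, zero_re,
      zero_im] at hre him
    ring_nf at hre him
    simp [hm.ne', hk.ne', hκ₀.ne'] at hre him
    rw [hre, him]
  · congr 1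
    rw [hz_deriv2 t, hz_deriv, hω4]
    simp only [map_mul, map_add, conj_ofReal, conj_I, mul_re, mul_im, add_re, add_im, neg_re,
      neg_im, ofReal_re, ofReal_im, I_re, I_im]
    field_simp
    ring_nf
    simp only [hc2]
    ring
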